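/- Let P be a discrete polymatroid of rank d on ground set [n] with ground set rank function ρ, and let I be the associated polymatroidal ideal. Then I = ∩_{p_F ∈ Ass(S/I)} p_F^{d − ρ([n]\F)}, and this is the canonical (unique irredundant) presentation of I as an intersection of powers of monomial prime ideals. -/

import Mathlib

open MvPolynomial

noncomputable section

variable (K : Type) [Field K]

/-- The monomial prime ideal `p_F` generated by the variables `x_i`, `i ∈ F`. -/
def monomialPrimeIdeal {n : ℕ} (F : Finset (Fin n)) : Ideal (MvPolynomial (Fin n) K) :=
  Ideal.span ((fun i => (X i : MvPolynomial (Fin n) K)) '' F)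

/-- A monomial ideal: an ideal generated by monomials. -/
def IsMonomialIdeal {σ : Type*} (I : Ideal (MvPolynomial σ K)) : Prop :=
  ∃ A : Set (σ →₀ ℕ), I = Ideal.span ((fun u => (monomial u (1 : K))) '' A)

/-- The graded maximal ideal of a polynomial ring. -/
def maxIdeal (σ : Type*) : Ideal (MvPolynomial σ K) :=
  Ideal.span (Set.range (X : σ → MvPolynomial σ K))

/-- The monomial localization map `S → S(p_F)`, sending `x_i ↦ x_i` for `i ∈ F`
and `x_i ↦ 1` otherwise. -/
def monomialLocalizationMap {n : ℕ} (F : Finset (Fin n)) :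
    MvPolynomial (Fin n) K →+* MvPolynomial {i : Fin n // i ∈ F} K :=
  (aeval (fun i : Fin n =>
    if h : i ∈ F then (X ⟨i, h⟩ : MvPolynomial {i : Fin n // i ∈ F} K) else 1)).toRingHom

/-- The monomial localization `I(p_F) ⊆ S(p_F)` of a monomial ideal `I`. -/
def mLoc {n : ℕ} (I : Ideal (MvPolynomial (Fin n) K)) (F : Finset (Fin n)) :
    Ideal (MvPolynomial {i : Fin n // i ∈ F} K) :=
  I.map (monomialLocalizationMap K F)

/-- `min(J)`: the minimal degree of a nonzero homogeneous element of `J`, which for a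
graded ideal is the minimal degree of a generator. -/
def minGenDeg {σ : Type*} (J : Ideal (MvPolynomial σ K)) : ℕ :=
  sInf {d : ℕ | ∃ f ∈ J, f ≠ 0 ∧ MvPolynomial.IsHomogeneous f d}

/-- `max(Soc(S/J))`: the maximal degree of a nonzero homogeneous element of the
socle `(J : m)/J` of `S/J`. -/
def maxSocleDeg {σ : Type*} (J : Ideal (MvPolynomial σ K)) : ℕ :=
  sSup {d : ℕ | ∃ f : MvPolynomial σ K, f ∉ J ∧ MvPolynomial.IsHomogeneous f d ∧
    ∀ i : σ, X i * f ∈ J}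

/-- `I` is of intersection type: `I` is an intersection of (positive) powers of
monomial prime ideals. -/
def IsIntersectionType {n : ℕ} (I : Ideal (MvPolynomial (Fin n) K)) : Prop :=
  ∃ (r : ℕ) (F : Fin r → Finset (Fin n)) (d : Fin r → ℕ),
    (∀ i, 0 < d i) ∧ I = ⨅ i, (monomialPrimeIdeal K (F i)) ^ (d i)

/-- A discrete polymatroid on the ground set `[n]`: a nonempty finite set of integer
vectors in `ℤ_{≥0}^n` closed under componentwise minimization and satisfying the
exchange property. -/
structure DiscretePolymatroid (n : ℕ) where
  carrier : Finset (Fin n →₀ ℕ)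
  nonempty : carrier.Nonempty
  lower : ∀ u ∈ carrier, ∀ v : Fin n →₀ ℕ, v ≤ u → v ∈ carrier
  exchange : ∀ u ∈ carrier, ∀ v ∈ carrier, (∑ i, u i) < (∑ i, v i) →
    ∃ i : Fin n, u i < v i ∧ u + Finsupp.single i 1 ∈ carrier

namespace DiscretePolymatroid

variable {n : ℕ} (P : DiscretePolymatroid n)

/-- The rank of `P`: the maximal modulus `|u| = ∑ i, u i` of an element of `P`. -/
def rank : ℕ := P.carrier.sup fun u => ∑ i, u i

/-- The set of bases of `P`: the elements of maximal modulus. -/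
def bases : Finset (Fin n →₀ ℕ) := P.carrier.filter fun u => (∑ i, u i) = P.rank

/-- The polymatroidal ideal associated with `P`: the ideal generated by the monomials
`x^u`, `u` a basis of `P`. -/
def toIdeal (K : Type) [Field K] : Ideal (MvPolynomial (Fin n) K) :=
  Ideal.span ((fun u => (monomial u (1 : K))) '' (P.bases : Set (Fin n →₀ ℕ)))

/-- The ground set rank function `ρ` of `P`: `ρ(F) = max {u(F) : u ∈ B(P)}`. -/
def rkFun (F : Finset (Fin n)) : ℕ := P.bases.sup fun u => ∑ i ∈ F, u i

/-- The complementary rank function `τ(F) = d - ρ([n] \ F)`. -/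
def crkFun (F : Finset (Fin n)) : ℕ := P.rank - P.rkFun Fᶜ

end DiscretePolymatroid

namespace DiscretePolymatroid

variable {n : ℕ} (P : DiscretePolymatroid n)

theorem mem_bases {u : Fin n →₀ ℕ} :
    u ∈ P.bases ↔ u ∈ P.carrier ∧ (∑ i, u i) = P.rank := by
  simp [bases]

theorem sum_le_rank {u : Fin n →₀ ℕ} (hu : u ∈ P.carrier) : (∑ i, u i) ≤ P.rank :=
  Finset.le_sup (f := fun u : Fin n →₀ ℕ => ∑ i, u i) hu

theorem le_rank {u : Fin n →₀ ℕ} (hu : u ∈ P.carrier) (i : Fin n) : u i ≤ P.rank :=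
  (Finset.single_le_sum (f := fun i => u i) (fun _ _ => Nat.zero_le _)
    (Finset.mem_univ i)).trans (P.sum_le_rank hu)

theorem bases_nonempty : P.bases.Nonempty := by
  obtain ⟨u, hu, h⟩ := Finset.exists_mem_eq_sup P.carrier P.nonempty
    (fun u : Fin n →₀ ℕ => ∑ i, u i)
  exact ⟨u, P.mem_bases.2 ⟨hu, h.symm⟩⟩

/-- A vector can be augmented from a vector of larger modulus until the moduli agree. -/
theorem exists_augmentation {w z : Fin n →₀ ℕ} (hw : w ∈ P.carrier) (hz : z ∈ P.carrier)
    (h : (∑ i, w i) ≤ ∑ i, z i) :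
    ∃ w' ∈ P.carrier, w ≤ w' ∧ w' ≤ w ⊔ z ∧ (∑ i, w' i) = ∑ i, z i := by
  obtain ⟨k, hk⟩ := Nat.exists_eq_add_of_le h
  induction k generalizing w with
  | zero => exact ⟨w, hw, le_rfl, le_sup_left, by omega⟩
  | succ k ih =>
    obtain ⟨j, hj, hmem⟩ := P.exchange w hw z hz (by omega)
    have hsum : (∑ i, (w + Finsupp.single j 1 : Fin n →₀ ℕ) i) = (∑ i, w i) + 1 := by
      simp [Finset.sum_add_distrib, Finsupp.single_apply]
    obtain ⟨w', hw', h1, h2, h3⟩ := ih hmem (by omega) (by omega)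
    refine ⟨w', hw', le_self_add.trans h1, h2.trans ?_, h3⟩
    refine sup_le (fun i => ?_) le_sup_right
    by_cases hij : j = i
    · subst hij
      simp only [Finsupp.add_apply, Finsupp.single_eq_same, Finsupp.sup_apply]
      omega
    · simp [hij]

theorem sum_le_rkFun {w : Fin n →₀ ℕ} (hw : w ∈ P.carrier) (G : Finset (Fin n)) :
    ∑ i ∈ G, w i ≤ P.rkFun G := by
  obtain ⟨b, hb⟩ := P.bases_nonempty
  obtain ⟨hb, hbs⟩ := P.mem_bases.1 hb
  obtain ⟨w', hw', h1, -, h3⟩ := P.exists_augmentation hw hb (hbs ▸ P.sum_le_rank hw)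
  exact (Finset.sum_le_sum fun i _ => h1 i).trans
    (Finset.le_sup (f := fun u : Fin n →₀ ℕ => ∑ i ∈ G, u i) (P.mem_bases.2 ⟨hw', h3.trans hbs⟩))

/-- `x^v` represents an element of `S/I` whose annihilator is `p_F`. The exponents outside `F` are
required to be at least the rank. -/
structure IsWitness (F : Finset (Fin n)) (v : Fin n →₀ ℕ) : Prop where
  not_le : ∀ u ∈ P.bases, ¬ u ≤ v
  exists_le : ∀ i ∈ F, ∃ u ∈ P.bases, u ≤ v + Finsupp.single i 1
  rank_le : ∀ i ∉ F, P.rank ≤ v i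

variable {P}

theorem IsWitness.nonempty {F : Finset (Fin n)} {v : Fin n →₀ ℕ} (h : P.IsWitness F v) :
    F.Nonempty := by
  by_contra hF
  rw [Finset.not_nonempty_iff_eq_empty] at hF
  obtain ⟨b, hb⟩ := P.bases_nonempty
  exact h.not_le b hb fun i =>
    (P.le_rank (P.mem_bases.1 hb).1 i).trans (h.rank_le i (by simp [hF]))

theorem IsWitness.exists_eq_add_one {F : Finset (Fin n)} {v : Fin n →₀ ℕ} (h : P.IsWitness F v)
    {i : Fin n} (hi : i ∈ F) :
    ∃ u ∈ P.bases, u i = v i + 1 ∧ ∀ j ≠ i, u j ≤ v j := by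
  obtain ⟨u, hu, hle⟩ := h.exists_le i hi
  have hne : ∀ j ≠ i, u j ≤ v j := fun j hj => by
    simpa [Finsupp.single_apply, hj.symm] using hle j
  refine ⟨u, hu, ?_, hne⟩
  have h1 : u i ≤ v i + 1 := by simpa using hle i
  by_contra h2
  refine h.not_le u hu fun j => ?_
  by_cases hj : j = i
  · subst hj; omega
  · exact hne j hj

/-- The `F`-degree of the exponent of a monomial with annihilator `p_F` is determined by the rank
function. -/
theorem IsWitness.sum_add_one {F : Finset (Fin n)} {v : Fin n →₀ ℕ} (h : P.IsWitness F v) :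
    ∑ i ∈ F, v i + 1 = P.rank - P.rkFun Fᶜ := by
  classical
  have hlt : ∀ w ∈ P.carrier, w ≤ v → ∑ i, w i < P.rank := fun w hw hwv =>
    lt_of_le_of_ne (P.sum_le_rank hw) fun he => h.not_le w (P.mem_bases.2 ⟨hw, he⟩) hwv
  obtain ⟨b, hb, hbF⟩ := Finset.exists_mem_eq_sup P.bases P.bases_nonempty
    (fun u : Fin n →₀ ℕ => ∑ i ∈ Fᶜ, u i)
  have hbc := (P.mem_bases.1 hb).1
  set b' : Fin n →₀ ℕ := b.filter (· ∈ Fᶜ) with hb'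
  have hb'c : b' ∈ P.carrier := P.lower b hbc b' fun i => by
    by_cases hi : i ∈ F <;> simp [hb', hi]
  have hb'v : b' ≤ v := fun i => by
    by_cases hi : i ∈ F
    · simp [hb', hi]
    · simpa [hb', Finsupp.filter_apply, hi] using (P.le_rank hbc i).trans (h.rank_le i hi)
  obtain ⟨i₀, hi₀⟩ := h.nonempty
  obtain ⟨u, hu, hui, huj⟩ := h.exists_eq_add_one hi₀
  obtain ⟨huc, hus⟩ := P.mem_bases.1 hu
  set z : Fin n →₀ ℕ := u - Finsupp.single i₀ 1 with hz
  have hzu : z + Finsupp.single i₀ 1 = u :=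
    tsub_add_cancel_of_le (Finsupp.single_le_iff.2 (by omega))
  have hzc : z ∈ P.carrier := P.lower u huc z tsub_le_self
  have hzv : z ≤ v := fun j => by
    by_cases hj : j = i₀
    · subst hj; simp [hz, hui]
    · exact (tsub_le_self (a := u) j).trans (huj j hj)
  have hzs : (∑ i, z i) + 1 = P.rank := by
    rw [← hus, ← hzu]
    simp [Finset.sum_add_distrib, Finsupp.single_apply]
  obtain ⟨w, hw, hbw, hwz, hws⟩ := P.exists_augmentation hb'c hzc
    (by have := hlt b' hb'c hb'v; omega)
  have hwv : w ≤ v := hwz.trans (sup_le hb'v hzv)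
  have hwF : ∀ i ∈ F, w i = v i := by
    intro i hi
    refine le_antisymm (hwv i) (not_lt.1 fun hlt' => ?_)
    obtain ⟨u, hu, hui, huj⟩ := h.exists_eq_add_one hi
    obtain ⟨huc, hus⟩ := P.mem_bases.1 hu
    obtain ⟨j, hj, hjc⟩ := P.exchange w hw u huc (by omega)
    have hle : w + Finsupp.single j 1 ≤ v := by
      intro k
      have hk := hwv k
      by_cases hkj : j = k
      · subst hkj
        simp only [Finsupp.add_apply, Finsupp.single_eq_same]
        by_cases hji : j = i
        · subst hji; omega
        · have := huj j hji; omega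
      · simpa [Finsupp.single_apply, hkj] using hk
    have := hlt _ hjc hle
    have hs : (∑ k, (w + Finsupp.single j 1 : Fin n →₀ ℕ) k) = (∑ k, w k) + 1 := by
      simp [Finset.sum_add_distrib, Finsupp.single_apply]
    omega
  have h1 : ∑ i ∈ Fᶜ, w i ≤ P.rkFun Fᶜ := P.sum_le_rkFun hw _
  have h2 : P.rkFun Fᶜ ≤ ∑ i ∈ Fᶜ, w i := by
    rw [rkFun, hbF]
    refine Finset.sum_le_sum fun i hi => ?_
    have := hbw i
    rwa [hb', Finsupp.filter_apply_pos _ _ hi] at this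
  have h3 : ∑ i ∈ F, w i + ∑ i ∈ Fᶜ, w i = ∑ i, w i := Finset.sum_add_sum_compl F _
  have h4 : ∑ i ∈ F, w i = ∑ i ∈ F, v i := Finset.sum_congr rfl hwF
  omega

variable (P)

/-- Every exponent that dominates no basis lies below a witness. -/
theorem exists_isWitness {v : Fin n →₀ ℕ} (hv : ∀ u ∈ P.bases, ¬ u ≤ v) :
    ∃ (F : Finset (Fin n)) (w : Fin n →₀ ℕ), v ≤ w ∧ P.IsWitness F w := by
  classical
  set c : Fin n →₀ ℕ := v ⊔ Finsupp.equivFunOnFinite.symm (fun _ => P.rank) with hc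
  have hfin : {w : Fin n →₀ ℕ | w ≤ c ∧ ∀ u ∈ P.bases, ¬ u ≤ w}.Finite :=
    (Set.finite_Iic c).subset fun w hw => hw.1
  obtain ⟨w, hvw, hw⟩ := hfin.exists_le_maximal (a := v) ⟨le_sup_left, hv⟩
  refine ⟨Finset.univ.filter fun i => ∃ u ∈ P.bases, u ≤ w + Finsupp.single i 1, w, hvw,
    hw.prop.2, fun i hi => (Finset.mem_filter.1 hi).2, fun i hi => ?_⟩
  have hi' : ∀ u ∈ P.bases, ¬ u ≤ w + Finsupp.single i 1 := by simpa using hi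
  by_contra hlt
  have hle : w + Finsupp.single i 1 ≤ c := by
    intro k
    have hk : w k ≤ c k := hw.prop.1 k
    by_cases hik : i = k
    · subst hik
      simp [hc]
      omega
    · simpa [Finsupp.single_apply, hik] using hk
  have := hw.le_of_ge (y := w + Finsupp.single i 1) ⟨hle, hi'⟩ le_self_add i
  simp at this

end DiscretePolymatroid

section MonomialPrime

variable {K} {n : ℕ}

theorem isPrime_monomialPrimeIdeal (F : Finset (Fin n)) : (monomialPrimeIdeal K F).IsPrime := by
  classical
  let φ : MvPolynomial (Fin n) K →ₐ[K] MvPolynomial (Fin n) K :=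
    aeval fun i => if i ∈ F then 0 else X i
  have hφ : (Ideal.Quotient.mkₐ K (monomialPrimeIdeal K F)).comp φ =
      Ideal.Quotient.mkₐ K (monomialPrimeIdeal K F) := by
    refine algHom_ext fun i => ?_
    by_cases hi : i ∈ F
    · simp only [AlgHom.comp_apply, φ, aeval_X, hi, if_true, map_zero]
      exact (Ideal.Quotient.eq_zero_iff_mem.2 (Ideal.subset_span (Set.mem_image_of_mem _ hi))).symm
    · simp [φ, hi]
  have : monomialPrimeIdeal K F = RingHom.ker φ := by
    refine le_antisymm (Ideal.span_le.2 ?_) fun f hf => ?_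
    · rintro _ ⟨i, hi, rfl⟩
      have hi' : i ∈ F := hi
      simp [RingHom.mem_ker, φ, hi']
    · have h := DFunLike.congr_fun hφ f
      rw [AlgHom.comp_apply, (RingHom.mem_ker).1 hf, map_zero] at h
      exact Ideal.Quotient.eq_zero_iff_mem.1 h.symm
  rw [this]
  exact RingHom.ker_isPrime _

theorem mem_monomialPrimeIdeal {F : Finset (Fin n)} {f : MvPolynomial (Fin n) K} :
    f ∈ monomialPrimeIdeal K F ↔ ∀ m ∈ f.support, ∃ i ∈ F, m i ≠ 0 :=
  mem_ideal_span_X_image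

theorem le_sum_of_mem_monomialPrimeIdeal_pow {F : Finset (Fin n)} {k : ℕ}
    {f : MvPolynomial (Fin n) K} (hf : f ∈ monomialPrimeIdeal K F ^ k) :
    ∀ v ∈ f.support, k ≤ ∑ i ∈ F, v i := by
  classical
  induction k generalizing f with
  | zero => simp
  | succ k ih =>
    rw [pow_succ] at hf
    refine Submodule.mul_induction_on hf (fun a ha b hb v hv => ?_) fun a b ha hb v hv => ?_
    · obtain ⟨s, hs, t, ht, rfl⟩ := Finset.mem_add.1 (support_mul a b hv)
      obtain ⟨i, hi, hti⟩ := mem_monomialPrimeIdeal.1 hb t ht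
      have h1 := ih ha s hs
      have h2 : t i ≤ ∑ i ∈ F, t i :=
        Finset.single_le_sum (f := fun i => t i) (fun _ _ => Nat.zero_le _) hi
      simp only [Finsupp.add_apply, Finset.sum_add_distrib]
      omega
    · rcases Finset.mem_union.1 (support_add hv) with h | h
      · exact ha v h
      · exact hb v h

theorem monomial_mem_monomialPrimeIdeal_pow {F : Finset (Fin n)} {k : ℕ} {v : Fin n →₀ ℕ}
    (hv : k ≤ ∑ i ∈ F, v i) : monomial v (1 : K) ∈ monomialPrimeIdeal K F ^ k := by
  classical
  refine Ideal.pow_le_pow_right hv ?_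
  have h : monomial v (1 : K) = ∏ i, X i ^ v i := by
    rw [monomial_eq, C_1, one_mul, Finsupp.prod_fintype]
    simp
  rw [h, ← Finset.prod_mul_prod_compl F, ← Finset.prod_pow_eq_pow_sum]
  exact Ideal.mul_mem_right _ _ (Ideal.prod_mem_prod fun i hi =>
    Ideal.pow_mem_pow (Ideal.subset_span (Set.mem_image_of_mem _ hi)) _)

end MonomialPrime

namespace DiscretePolymatroid

variable {K} {n : ℕ} (P : DiscretePolymatroid n)

theorem mem_toIdeal {f : MvPolynomial (Fin n) K} :
    f ∈ P.toIdeal K ↔ ∀ v ∈ f.support, ∃ u ∈ P.bases, u ≤ v :=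
  mem_ideal_span_monomial_image

theorem monomialPrimeIdeal_mem_associatedPrimes_iff (F : Finset (Fin n)) :
    monomialPrimeIdeal K F ∈
        associatedPrimes (MvPolynomial (Fin n) K) (MvPolynomial (Fin n) K ⧸ P.toIdeal K) ↔
      ∃ v, P.IsWitness F v := by
  classical
  rw [AssociatedPrimes.mem_iff, IsAssociatedPrime, Submodule.isAssociatedPrime_iff]
  have hcolon : ∀ r g : MvPolynomial (Fin n) K,
      r ∈ (⊥ : Submodule (MvPolynomial (Fin n) K) (MvPolynomial (Fin n) K ⧸ P.toIdeal K)).colon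
        {Ideal.Quotient.mk (P.toIdeal K) g} ↔ r * g ∈ P.toIdeal K := fun r g => by
    rw [Submodule.mem_colon_singleton, Submodule.mem_bot, ← Ideal.Quotient.eq_zero_iff_mem, map_mul]
    rfl
  constructor
  · rintro ⟨-, x, hx⟩
    obtain ⟨g, rfl⟩ := Ideal.Quotient.mk_surjective x
    have hg : ∀ r, r ∈ monomialPrimeIdeal K F ↔ r * g ∈ P.toIdeal K := fun r => by
      rw [hx, hcolon]
    set w : Fin n →₀ ℕ := Finsupp.equivFunOnFinite.symm fun i => if i ∈ F then 0 else P.rank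
      with hw
    have hs : monomial w (1 : K) ∉ monomialPrimeIdeal K F := by
      simp +contextual [mem_monomialPrimeIdeal, hw]
    rw [hg, mem_toIdeal] at hs
    push Not at hs
    obtain ⟨v, hv, hvb⟩ := hs
    refine ⟨v, hvb, fun i hi => ?_, fun i hi => ?_⟩
    · have hmem : X i * (monomial w (1 : K) * g) ∈ P.toIdeal K := by
        rw [mul_left_comm]
        exact Ideal.mul_mem_left _ _ ((hg _).1 (Ideal.subset_span (Set.mem_image_of_mem _ hi)))
      refine P.mem_toIdeal.1 hmem _ ?_
      rw [mem_support_iff, add_comm, coeff_X_mul]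
      exact mem_support_iff.1 hv
    · rw [mem_support_iff, coeff_monomial_mul'] at hv
      have hwv : w ≤ v := by
        by_contra hwv
        simp [hwv] at hv
      simpa [hw, hi] using hwv i
  · rintro ⟨v, hv⟩
    refine ⟨isPrime_monomialPrimeIdeal F, Ideal.Quotient.mk _ (monomial v 1), ?_⟩
    ext r
    rw [hcolon, mem_toIdeal, mem_monomialPrimeIdeal]
    constructor
    · intro h m hm
      rw [mem_support_iff, coeff_mul_monomial'] at hm
      have hvm : v ≤ m := by
        by_contra hvm
        simp [hvm] at hm
      obtain ⟨i, hi, hmi⟩ := h (m - v) (by simpa [hvm] using hm)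
      obtain ⟨u, hu, hle⟩ := hv.exists_le i hi
      refine ⟨u, hu, hle.trans fun j => ?_⟩
      have := hvm j
      by_cases hij : i = j
      · subst hij
        simp at hmi ⊢
        omega
      · simpa [Finsupp.single_apply, hij] using this
    · intro h m hm
      obtain ⟨u, hu, hle⟩ := h (m + v) (by simpa [coeff_mul_monomial] using hm)
      by_contra! hcon
      refine hv.not_le u hu fun i => ?_
      by_cases hi : i ∈ F
      · simpa [hcon i hi] using hle i
      · exact (P.le_rank (P.mem_bases.1 hu).1 i).trans (hv.rank_le i hi)

/-- The extension of an exponent on `F` to `[n]` by the rank of `P`. -/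
def extendByRank (F : Finset (Fin n)) (w : {i : Fin n // i ∈ F} →₀ ℕ) : Fin n →₀ ℕ :=
  Finsupp.equivFunOnFinite.symm fun i => if h : i ∈ F then w ⟨i, h⟩ else P.rank

theorem extendByRank_apply_mem {F : Finset (Fin n)} (w : {i : Fin n // i ∈ F} →₀ ℕ)
    {i : Fin n} (hi : i ∈ F) : P.extendByRank F w i = w ⟨i, hi⟩ := by
  simp [extendByRank, hi]

theorem extendByRank_apply_notMem {F : Finset (Fin n)} (w : {i : Fin n // i ∈ F} →₀ ℕ)
    {i : Fin n} (hi : i ∉ F) : P.extendByRank F w i = P.rank := by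
  simp [extendByRank, hi]

theorem subtypeDomain_le_iff {F : Finset (Fin n)} {w : {i : Fin n // i ∈ F} →₀ ℕ}
    {u : Fin n →₀ ℕ} (hu : u ∈ P.bases) :
    u.subtypeDomain (· ∈ F) ≤ w ↔ u ≤ P.extendByRank F w := by
  constructor
  · intro h i
    by_cases hi : i ∈ F
    · rw [P.extendByRank_apply_mem w hi]
      exact h ⟨i, hi⟩
    · rw [P.extendByRank_apply_notMem w hi]
      exact P.le_rank (P.mem_bases.1 hu).1 i
  · rintro h ⟨i, hi⟩
    rw [← P.extendByRank_apply_mem w hi]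
    exact h i

theorem monomialLocalizationMap_monomial (F : Finset (Fin n)) (u : Fin n →₀ ℕ) :
    monomialLocalizationMap K F (monomial u 1) = monomial (u.subtypeDomain (· ∈ F)) 1 := by
  classical
  have h : monomialLocalizationMap K F (monomial u 1) =
      ∏ i, (if h : i ∈ F then (X ⟨i, h⟩ : MvPolynomial {i : Fin n // i ∈ F} K) else 1) ^ u i := by
    change aeval _ (monomial u (1 : K)) = _
    rw [aeval_monomial, map_one, one_mul, Finsupp.prod_fintype]
    simp
  rw [h, ← Finset.prod_mul_prod_compl F, Finset.prod_eq_one (s := Fᶜ), mul_one,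
    ← Finset.prod_coe_sort, monomial_eq, C_1, one_mul, Finsupp.prod_fintype]
  · simp
  · simp
  · intro i hi
    simp [Finset.mem_compl.1 hi]

theorem mem_mLoc_toIdeal {F : Finset (Fin n)} {f : MvPolynomial {i : Fin n // i ∈ F} K} :
    f ∈ mLoc K (P.toIdeal K) F ↔ ∀ w ∈ f.support, ∃ u ∈ P.bases, u ≤ P.extendByRank F w := by
  have : mLoc K (P.toIdeal K) F = Ideal.span ((fun s => monomial s (1 : K)) ''
      ((fun u : Fin n →₀ ℕ => u.subtypeDomain (· ∈ F)) '' (P.bases : Set (Fin n →₀ ℕ)))) := by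
    rw [mLoc, toIdeal, Ideal.map_span, Set.image_image, Set.image_image]
    simp_rw [monomialLocalizationMap_monomial]
  rw [this, mem_ideal_span_monomial_image]
  refine forall₂_congr fun w _ => ?_
  simp only [Set.exists_mem_image, Finset.mem_coe]
  exact exists_congr fun u => and_congr_right fun hu => P.subtypeDomain_le_iff hu

theorem extendByRank_add_single {F : Finset (Fin n)} (w : {i : Fin n // i ∈ F} →₀ ℕ)
    (i : {i : Fin n // i ∈ F}) :
    P.extendByRank F (w + Finsupp.single i 1) =
      P.extendByRank F w + Finsupp.single i.1 1 := by
  classical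
  ext j
  by_cases hj : j ∈ F
  · simp [extendByRank_apply_mem, hj, Finsupp.single_apply, Subtype.ext_iff]
  · have : i.1 ≠ j := fun h => hj (h ▸ i.2)
    simp [extendByRank_apply_notMem, hj, this]

theorem sum_extendByRank (F : Finset (Fin n)) (w : {i : Fin n // i ∈ F} →₀ ℕ) :
    ∑ i ∈ F, P.extendByRank F w i = w.degree := by
  rw [Finsupp.degree_eq_sum, ← Finset.sum_coe_sort]
  exact Finset.sum_congr rfl fun i _ => P.extendByRank_apply_mem w i.2

theorem IsWitness.extendByRank {P : DiscretePolymatroid n} {F : Finset (Fin n)} {v : Fin n →₀ ℕ}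
    (h : P.IsWitness F v) : P.IsWitness F (P.extendByRank F (v.subtypeDomain (· ∈ F))) := by
  refine ⟨fun u hu hle => ?_, fun i hi => ?_, fun i hi => (P.extendByRank_apply_notMem _ hi).ge⟩
  · refine h.not_le u hu fun i => ?_
    by_cases hi : i ∈ F
    · simpa [P.extendByRank_apply_mem _ hi] using hle i
    · exact (P.le_rank (P.mem_bases.1 hu).1 i).trans (h.rank_le i hi)
  · obtain ⟨u, hu, hle⟩ := h.exists_le i hi
    refine ⟨u, hu, ?_⟩
    rw [← P.extendByRank_add_single _ ⟨i, hi⟩, ← P.subtypeDomain_le_iff hu]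
    intro j
    simpa [Finsupp.single_apply, Subtype.ext_iff] using hle j.1

/-- The socle of `S(p_F)/I(p_F)` is concentrated in a single degree. -/
theorem maxSocleDeg_mLoc_add_one {F : Finset (Fin n)} {v : Fin n →₀ ℕ} (h : P.IsWitness F v) :
    maxSocleDeg K (mLoc K (P.toIdeal K) F) + 1 = P.rank - P.rkFun Fᶜ := by
  classical
  have hset : {d : ℕ | ∃ f : MvPolynomial {i : Fin n // i ∈ F} K,
      f ∉ mLoc K (P.toIdeal K) F ∧ MvPolynomial.IsHomogeneous f d ∧
        ∀ i, X i * f ∈ mLoc K (P.toIdeal K) F} = {P.rank - P.rkFun Fᶜ - 1} := by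
    ext d
    rw [Set.mem_ofPred_eq, Set.mem_singleton_iff]
    constructor
    · rintro ⟨f, hf, hd, hX⟩
      rw [mem_mLoc_toIdeal] at hf
      push Not at hf
      obtain ⟨w, hw, hwb⟩ := hf
      have hwit : P.IsWitness F (P.extendByRank F w) := by
        refine ⟨hwb, fun i hi => ?_, fun i hi => (P.extendByRank_apply_notMem _ hi).ge⟩
        rw [← P.extendByRank_add_single w ⟨i, hi⟩]
        refine P.mem_mLoc_toIdeal.1 (hX ⟨i, hi⟩) _ ?_
        rw [mem_support_iff, add_comm, coeff_X_mul]
        exact mem_support_iff.1 hw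
      have h1 := hwit.sum_add_one
      rw [sum_extendByRank] at h1
      have h2 : w.degree = d := by
        rw [Finsupp.degree_eq_weight_one]
        exact hd (mem_support_iff.1 hw)
      omega
    · rintro rfl
      have hwit := h.extendByRank
      have h1 := hwit.sum_add_one
      rw [sum_extendByRank] at h1
      refine ⟨monomial (v.subtypeDomain (· ∈ F)) 1, fun hmem => ?_,
        isHomogeneous_monomial _ (by omega), fun i => ?_⟩
      · obtain ⟨u, hu, hle⟩ := P.mem_mLoc_toIdeal.1 hmem (v.subtypeDomain (· ∈ F)) (by simp)
        exact hwit.not_le u hu hle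
      · rw [mem_mLoc_toIdeal]
        intro w hw
        rw [X, monomial_mul, mul_one, support_monomial, if_neg one_ne_zero,
          Finset.mem_singleton] at hw
        rw [hw, add_comm, extendByRank_add_single]
        exact hwit.exists_le i.1 i.2
  rw [maxSocleDeg, hset, csSup_singleton]
  have := h.sum_add_one
  omega

theorem rank_sub_rkFun_compl_le {u : Fin n →₀ ℕ} (hu : u ∈ P.bases) (F : Finset (Fin n)) :
    P.rank - P.rkFun Fᶜ ≤ ∑ i ∈ F, u i := by
  obtain ⟨huc, hus⟩ := P.mem_bases.1 hu
  have h1 := P.sum_le_rkFun huc Fᶜ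
  have h2 : ∑ i ∈ F, u i + ∑ i ∈ Fᶜ, u i = ∑ i, u i := Finset.sum_add_sum_compl F _
  omega

end DiscretePolymatroid

/-- Let `P` be a discrete polymatroid of rank `d` with ground set rank
function `ρ` and `I` the associated polymatroidal ideal. Then
`I = ⋂_{p_F ∈ Ass(S/I)} p_F^{d - ρ([n]\F)}`, and this is the canonical (unique
irredundant) presentation of `I` as an intersection of powers of monomial primes,
i.e. the exponents are `max(Soc(S(p_F)/I(p_F))) + 1`. -/
theorem polymatroidal_canonical_primary_decomposition {n : ℕ}
    (P : DiscretePolymatroid n) (I : Ideal (MvPolynomial (Fin n) K))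
    (hI : I = P.toIdeal K) :
    (I = ⨅ F ∈ {F : Finset (Fin n) | monomialPrimeIdeal K F ∈
        associatedPrimes (MvPolynomial (Fin n) K) (MvPolynomial (Fin n) K ⧸ I)},
      (monomialPrimeIdeal K F) ^ (P.rank - P.rkFun Fᶜ)) ∧
    ∀ F : Finset (Fin n),
      monomialPrimeIdeal K F ∈
          associatedPrimes (MvPolynomial (Fin n) K) (MvPolynomial (Fin n) K ⧸ I) →
        P.rank - P.rkFun Fᶜ = maxSocleDeg K (mLoc K I F) + 1 := by
  subst hI
  refine ⟨le_antisymm ?_ fun f hf => ?_, fun F hF => ?_⟩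
  · refine le_iInf₂ fun F _ => Ideal.span_le.2 ?_
    rintro _ ⟨u, hu, rfl⟩
    exact monomial_mem_monomialPrimeIdeal_pow (P.rank_sub_rkFun_compl_le hu F)
  · rw [P.mem_toIdeal]
    by_contra! hcon
    obtain ⟨v, hv, hvb⟩ := hcon
    obtain ⟨F, w, hvw, hw⟩ := P.exists_isWitness hvb
    have hFmem := (P.monomialPrimeIdeal_mem_associatedPrimes_iff (K := K) F).2 ⟨w, hw⟩
    have h1 := le_sum_of_mem_monomialPrimeIdeal_pow (Ideal.mem_iInf.1 (Ideal.mem_iInf.1 hf F) hFmem)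
      v hv
    have h2 : ∑ i ∈ F, v i ≤ ∑ i ∈ F, w i := Finset.sum_le_sum fun i _ => hvw i
    have h3 := hw.sum_add_one
    omega
  · obtain ⟨v, hv⟩ := (P.monomialPrimeIdeal_mem_associatedPrimes_iff F).1 hF
    exact (P.maxSocleDeg_mLoc_add_one hv).symm


end
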